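/- Let φ be a Sturmian coloring of a d-regular tree and let D be a class of n-balls not equal to any of A_n, B_n, S_n. Then: (1) if S_n and D can be adjacent, then S_n and D are always adjacent; (2) if moreover D ≠ C_n, then S_n ≠ C_n; (3) apart from S_n itself, at most three classes of n-balls can be adjacent to S_n. -/

import Mathlib

open scoped Classical

noncomputable section

namespace Sturm

variable {V α : Type}

/-- `G` is a `d`-regular tree. -/
structure IsRegularTree (G : SimpleGraph V) (d : ℕ) : Prop where
  isTree : G.IsTree
  regular : ∀ v : V, (G.neighborSet v).ncard = d

/-- Color-preserving isomorphism of the `n`-balls centered at `x` and `y`,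
sending center to center. -/
def BallEquiv (G : SimpleGraph V) (φ : V → α) (n : ℕ) (x y : V) : Prop :=
  ∃ f : {z : V // G.dist x z ≤ n} ≃ {z : V // G.dist y z ≤ n},
    (∀ u v : {z : V // G.dist x z ≤ n}, G.Adj u.1 v.1 ↔ G.Adj (f u).1 (f v).1) ∧
    (∀ u : {z : V // G.dist x z ≤ n}, φ (f u).1 = φ u.1) ∧
    ((f ⟨x, by rw [SimpleGraph.dist_self]; exact Nat.zero_le n⟩).1 = y)

/-- The class of the `n`-ball at `x`, viewed as the set of all centers of equivalent balls. -/
def ballClass (G : SimpleGraph V) (φ : V → α) (n : ℕ) (x : V) : Set V :=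
  {y | BallEquiv G φ n x y}

/-- The set `B_n(φ)` of classes of `n`-balls occurring in `(T, φ)`. -/
def ballClasses (G : SimpleGraph V) (φ : V → α) (n : ℕ) : Set (Set V) :=
  {C | ∃ x, C = ballClass G φ n x}

/-- A coloring is Sturmian if its factor complexity is `n + 2`. -/
def IsSturmian (G : SimpleGraph V) (φ : V → α) : Prop :=
  ∀ n, (ballClasses G φ n).ncard = n + 2

/-- `x` is the center of a special `n`-ball. -/
def IsSpecialVert (G : SimpleGraph V) (φ : V → α) (n : ℕ) (x : V) : Prop :=
  ∃ y, BallEquiv G φ n x y ∧ ¬ BallEquiv G φ (n + 1) x y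

/-- `S` is a special class of `n`-balls: the restriction of two distinct classes of
`(n+1)`-balls. -/
def IsSpecialClass (G : SimpleGraph V) (φ : V → α) (n : ℕ) (S : Set V) : Prop :=
  ∃ x, S = ballClass G φ n x ∧ IsSpecialVert G φ n x

/-- The class `D` is always adjacent to the class `E`. -/
def AlwaysAdjTo (G : SimpleGraph V) (D E : Set V) : Prop :=
  ∀ x ∈ D, ∃ y, G.Adj x y ∧ y ∈ E

/-- The classes `D` and `E` are (always) adjacent. -/
def AlwaysAdj (G : SimpleGraph V) (D E : Set V) : Prop :=
  AlwaysAdjTo G D E ∧ AlwaysAdjTo G E D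

/-- The classes `D` and `E` can be adjacent. -/
def CanAdj (G : SimpleGraph V) (D E : Set V) : Prop :=
  ∃ x ∈ D, ∃ y ∈ E, G.Adj x y

/-- The number of neighbors of `x` lying in (i.e. being centers of balls of class) `E`. -/
def nbrCount (G : SimpleGraph V) (x : V) (E : Set V) : ℕ :=
  (G.neighborSet x ∩ E).ncard

/-- The data of the labels `S_n, C_n, A_n, B_n` for a Sturmian coloring, normalized as in
the paper: `S_0 = A_0 = [a]`, `B_0 = [b]`, `A_{n+1}` (resp. `B_{n+1}`) is always adjacent
to `A_n` (resp. `B_n`), and `A_{n+1}, B_{n+1}` are the two distinct extensions of `S_n`. -/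
structure Labeling (G : SimpleGraph V) (φ : V → α) (a b : α) where
  S : ℕ → Set V
  C : ℕ → Set V
  A : ℕ → Set V
  B : ℕ → Set V
  S_special : ∀ n, IsSpecialClass G φ n (S n)
  C_central : ∀ n, ∃ x, IsSpecialVert G φ (n + 1) x ∧ S (n + 1) = ballClass G φ (n + 1) x ∧
      C n = ballClass G φ n x
  A0_eq_S0 : A 0 = S 0
  A0_col : ∃ x, φ x = a ∧ A 0 = ballClass G φ 0 x
  B0_col : ∃ x, φ x = b ∧ B 0 = ballClass G φ 0 x
  A_ext : ∀ n, ∃ x, IsSpecialVert G φ n x ∧ S n = ballClass G φ n x ∧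
      A (n + 1) = ballClass G φ (n + 1) x
  B_ext : ∀ n, ∃ x, IsSpecialVert G φ n x ∧ S n = ballClass G φ n x ∧
      B (n + 1) = ballClass G φ (n + 1) x
  AB_ne : ∀ n, A (n + 1) ≠ B (n + 1)
  A_adj : ∀ n, AlwaysAdjTo G (A (n + 1)) (A n)
  B_adj : ∀ n, AlwaysAdjTo G (B (n + 1)) (B n)

/-- A cycle (of length `≥ 3`, with pairwise distinct vertices) in the graph `G_n` of
classes of `n`-balls, where classes are joined when they can be adjacent. -/
def IsCycleIn (G : SimpleGraph V) (φ : V → α) (n k : ℕ) (c : ℕ → Set V) : Prop :=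
  3 ≤ k ∧ (∀ i < k, c i ∈ ballClasses G φ n) ∧
    (∀ i < k, CanAdj G (c i) (c ((i + 1) % k))) ∧
    (∀ i < k, ∀ j < k, c i = c j → i = j)

/-- The graph `G_n` contains a cycle. -/
def HasCycle (G : SimpleGraph V) (φ : V → α) (n : ℕ) : Prop :=
  ∃ k c, IsCycleIn G φ n k c

/-! ## Edge-indexed colored graphs -/

/-- An edge-indexed graph, with vertices colored by `α` and labeled by classes
(sets of vertices of the underlying tree `V`). Index `0` means "no edge". -/
structure EIG (V α : Type) where
  Vert : Type
  idx : Vert → Vert → ℕ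
  col : Vert → α
  lab : Vert → Set V

/-- Isomorphism of colored edge-indexed graphs. -/
structure EIGIso (X Y : EIG V α) where
  e : X.Vert ≃ Y.Vert
  idx_eq : ∀ u v, Y.idx (e u) (e v) = X.idx u v
  col_eq : ∀ u, Y.col (e u) = X.col u

/-- The index `i_A(D, E)` (resp. `i_B`, `i`) at the level of classes: the number of
neighbors, in class `E`, of a representative center of `D`; when `D` is the special
class `Sp`, the representative is taken with extension of class `Ext`. -/
def classIdx (G : SimpleGraph V) (Sp Ext : Set V) (D E : Set V) : ℕ :=
  if D = Sp then (if h : Ext.Nonempty then nbrCount G h.some E else 0)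
  else (if h : D.Nonempty then nbrCount G h.some E else 0)

/-- The classes of `n`-balls joined to `Sp` by a path of edges of positive `J`-index. -/
def reachSet (G : SimpleGraph V) (φ : V → α) (n : ℕ) (Sp : Set V)
    (J : Set V → Set V → ℕ) : Set (Set V) :=
  {D | ∃ k, ∃ c : ℕ → Set V, c 0 = Sp ∧ c k = D ∧ (∀ i ≤ k, c i ∈ ballClasses G φ n) ∧
    ∀ i < k, 0 < J (c i) (c (i + 1)) ∨ 0 < J (c (i + 1)) (c i)}

/-- Color of a class: the color of (the center of) any of its representatives. -/
def colOf [Nonempty V] (φ : V → α) (D : Set V) : α :=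
  if h : D.Nonempty then φ h.some else φ (Classical.arbitrary V)

/-- The edge-indexed graph `G^A_n` (when `Ext = A_{n+1}`) resp. `G^B_n`. -/
def sideEIG [Nonempty V] (G : SimpleGraph V) (φ : V → α) (n : ℕ) (Sp Ext : Set V) :
    EIG V α where
  Vert := {D : Set V // D ∈ reachSet G φ n Sp (classIdx G Sp Ext)}
  idx := fun D E => classIdx G Sp Ext D.1 E.1
  col := fun D => colOf φ D.1
  lab := fun D => D.1

variable {G : SimpleGraph V} {φ : V → α} {a b : α}

/-- The edge-indexed graph `G^A_n`. -/
def GAeig [Nonempty V] (L : Labeling G φ a b) (n : ℕ) : EIG V α :=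
  sideEIG G φ n (L.S n) (L.A (n + 1))

/-- The edge-indexed graph `G^B_n`. -/
def GBeig [Nonempty V] (L : Labeling G φ a b) (n : ℕ) : EIG V α :=
  sideEIG G φ n (L.S n) (L.B (n + 1))

/-- Vertex set of `G^A_n`. -/
def VGAset (L : Labeling G φ a b) (n : ℕ) : Set (Set V) :=
  reachSet G φ n (L.S n) (classIdx G (L.S n) (L.A (n + 1)))

/-- Vertex set of `G^B_n`. -/
def VGBset (L : Labeling G φ a b) (n : ℕ) : Set (Set V) :=
  reachSet G φ n (L.S n) (classIdx G (L.S n) (L.B (n + 1)))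

/-- `G^A_n` or `G^B_n`, selected by a letter (`true = A`, `false = B`). -/
def GsideEIG [Nonempty V] (L : Labeling G φ a b) (n : ℕ) : Bool → EIG V α
  | true => GAeig L n
  | false => GBeig L n

/-- Vertex set of `G^A_n` or `G^B_n`, selected by a letter. -/
def VGside (L : Labeling G φ a b) (n : ℕ) : Bool → Set (Set V)
  | true => VGAset L n
  | false => VGBset L n

/-- A single vertex with a loop of index `d` (the graph `G^A_{-1} = G^B_{-1} = F^._{-1}`). -/
def baseEIG (V : Type) (x : α) (d : ℕ) : EIG V α where
  Vert := PUnit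
  idx := fun _ _ => d
  col := fun _ => x
  lab := fun _ => Set.univ

/-- `GAx L d (n+1) = G^A_n`, and `GAx L d 0 = G^A_{-1}`. -/
def GAx [Nonempty V] (L : Labeling G φ a b) (d : ℕ) : ℕ → EIG V α
  | 0 => baseEIG V a d
  | n + 1 => GAeig L n

/-- `GBx L d (n+1) = G^B_n`, and `GBx L d 0 = G^B_{-1}`. -/
def GBx [Nonempty V] (L : Labeling G φ a b) (d : ℕ) : ℕ → EIG V α
  | 0 => baseEIG V b d
  | n + 1 => GBeig L n

/-- `Cx L (n+1) = C_n`, and `Cx L 0 = C_{-1}` (the class of the empty ball). -/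
def Cx (L : Labeling G φ a b) : ℕ → Set V
  | 0 => Set.univ
  | n + 1 => L.C n

/-! ## Concatenations -/

/-- The `(i)`-concatenation of two edge-indexed graphs at the end vertices `v, v'`
(which are identified). -/
def concatI (X Y : EIG V α) (v : X.Vert) (v' : Y.Vert) (i : ℕ) : EIG V α where
  Vert := X.Vert ⊕ {w : Y.Vert // w ≠ v'}
  idx := fun p q =>
    match p, q with
    | Sum.inl u, Sum.inl w =>
        if u = v ∧ w ≠ v then (if X.idx u w = 0 then 0 else i) else X.idx u w
    | Sum.inl u, Sum.inr w => if u = v then Y.idx v' w.1 - i else 0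
    | Sum.inr w, Sum.inl u => if u = v then Y.idx w.1 v' else 0
    | Sum.inr w, Sum.inr w2 => Y.idx w.1 w2.1
  col := Sum.elim X.col (fun w => Y.col w.1)
  lab := Sum.elim X.lab (fun w => Y.lab w.1)

/-- The `(i,j)`-concatenation of two edge-indexed graphs at the end vertices `v, v'`
(which stay distinct, joined by a new edge of indices `i`, `j`). -/
def concatIJ (X Y : EIG V α) (v : X.Vert) (v' : Y.Vert) (i j : ℕ) : EIG V α where
  Vert := X.Vert ⊕ Y.Vert
  idx := fun p q =>
    match p, q with
    | Sum.inl u, Sum.inl w => if u = v ∧ w = v then X.idx v v - i else X.idx u w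
    | Sum.inl u, Sum.inr w => if u = v ∧ w = v' then i else 0
    | Sum.inr w, Sum.inl u => if w = v' ∧ u = v then j else 0
    | Sum.inr u, Sum.inr w => if u = v' ∧ w = v' then Y.idx v' v' - j else Y.idx u w
  col := Sum.elim X.col Y.col
  lab := Sum.elim X.lab Y.lab

/-- `Z` is a concatenation ((i)- or (i,j)-) of `X` and `Y` at `(vX, vY)`. -/
def IsConcatOfAt (Z X Y : EIG V α) (vX : X.Vert) (vY : Y.Vert) : Prop :=
  (∃ i, 1 ≤ i ∧ Nonempty (EIGIso Z (concatI X Y vX vY i))) ∨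
  (∃ i j, 1 ≤ i ∧ 1 ≤ j ∧ Nonempty (EIGIso Z (concatIJ X Y vX vY i j)))

/-! ## Paths, distance, degree in edge-indexed graphs -/

/-- Adjacency (by an edge of positive index, in one of the two orientations). -/
def EIGAdj (X : EIG V α) (u w : X.Vert) : Prop :=
  u ≠ w ∧ (0 < X.idx u w ∨ 0 < X.idx w u)

/-- There is a path of length `L` from `u` to `w`. -/
def EIGReach (X : EIG V α) (u w : X.Vert) (L : ℕ) : Prop :=
  ∃ c : ℕ → X.Vert, c 0 = u ∧ c L = w ∧ ∀ i < L, EIGAdj X (c i) (c (i + 1))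

/-- Graph distance in an edge-indexed graph. -/
def EIGDist (X : EIG V α) (u w : X.Vert) : ℕ :=
  sInf {L | EIGReach X u w L}

/-- `u` has degree one: there is exactly one vertex adjacent to it. -/
def EIGEndVert (X : EIG V α) (u : X.Vert) : Prop :=
  ∃! w, EIGAdj X u w

/-! ## Coverings, direct limits, quotient graph, bounded type -/

/-- `p` exhibits the graph `H` as the universal cover of the edge-indexed graph `Y`:
above a vertex mapping to `u`, the number of neighbors above `w` is the index `idx u w`. -/
def IsEIGCover {W : Type} (H : SimpleGraph W) (Y : EIG V α) (p : W → Y.Vert) : Prop :=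
  ∀ x : W, ∀ u : Y.Vert, (H.neighborSet x ∩ p ⁻¹' {u}).ncard = Y.idx (p x) u

/-- `Y` is the direct limit of the system `F` of colored edge-indexed graphs along the
inclusions `ι`. -/
def IsDirLimit (F : ℕ → EIG V α) (ι : ∀ k, (F k).Vert → (F (k + 1)).Vert)
    (Y : EIG V α) : Prop :=
  ∃ j : ∀ k, (F k).Vert → Y.Vert,
    (∀ k v, j (k + 1) (ι k v) = j k v) ∧
    (∀ k, Function.Injective (j k)) ∧
    (∀ y, ∃ k v, j k v = y) ∧
    (∀ k v, Y.col (j k v) = (F k).col v) ∧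
    (∀ y z : Y.Vert, ∃ N, ∀ k, N ≤ k → ∀ v w, j k v = y → j k w = z →
      Y.idx y z = (F k).idx v w)

/-- The coloring `φ` is of bounded type: every vertex has finite type set. -/
def BoundedType (G : SimpleGraph V) (φ : V → α) : Prop :=
  ∀ v : V, {m : ℕ | IsSpecialVert G φ m v}.Finite

/-- Two vertices are related if some color-preserving automorphism maps one to the other. -/
def colorOrbitRel (G : SimpleGraph V) (φ : V → α) (x y : V) : Prop :=
  ∃ g : V ≃ V, (∀ u w, G.Adj u w ↔ G.Adj (g u) (g w)) ∧ (∀ u, φ (g u) = φ u) ∧ g x = y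

/-- The quotient graph `X_φ = G\T` as a colored edge-indexed graph. -/
def quotEIG (G : SimpleGraph V) (φ : V → α) : EIG V α where
  Vert := Quot (colorOrbitRel G φ)
  idx := fun u w => (G.neighborSet u.out ∩ {z | Quot.mk (colorOrbitRel G φ) z = w}).ncard
  col := fun u => φ u.out
  lab := fun u => {z | Quot.mk (colorOrbitRel G φ) z = u}

/-! ## The sequences `n_k`, `α_k`, `β_k` -/

/-- At level `n`, one of `A_n, B_n` is `S_n` or `C_n`. -/
def SpecTouch (L : Labeling G φ a b) (n : ℕ) : Prop :=
  L.A n = L.S n ∨ L.A n = L.C n ∨ L.B n = L.S n ∨ L.B n = L.C n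

/-- `nk` is the increasing enumeration of the levels where `SpecTouch` holds. -/
def IsNkSeq (L : Labeling G φ a b) (nk : ℕ → ℕ) : Prop :=
  StrictMono nk ∧ ∀ n, (∃ k, nk k = n) ↔ SpecTouch L n

/-- `αs` is the sequence `α_k`: `α_K = A`, and for `k ≠ K`, `α_k` is the side whose
graph `G^{α_k}_{n_k}` has more vertices. -/
def IsAlphaSeq (L : Labeling G φ a b) (nk : ℕ → ℕ) (K : ℕ∞) (αs : ℕ → Bool) : Prop :=
  ∀ k : ℕ, ((k : ℕ∞) = K → αs k = true) ∧
    ((k : ℕ∞) ≠ K → (αs k = true ↔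
      (VGside L (nk k) false).ncard < (VGside L (nk k) true).ncard))

/-- The sequence `β_k(t)`: `β_{k-1}(t)` is the letter `ᾱ_k` if the class of the
`n_k`-ball at `t` is a vertex of `G^{ᾱ_k}_{n_k}`, and `α_k` otherwise. -/
def betaOf (L : Labeling G φ a b) (nk : ℕ → ℕ) (αs : ℕ → Bool) (t : V) (k : ℕ) : Bool :=
  if ballClass G φ (nk (k + 1)) t ∈ VGside L (nk (k + 1)) (!(αs (k + 1))) then
    !(αs (k + 1))
  else αs (k + 1)

end Sturm

namespace Sturm

/-- A decreasing sequence of equivalence relations on the vertices of a connected graph of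
degree at most `d` in which, at each step `n`, exactly the class of `s n` splits, into the
classes of `a (n + 1)` and `b (n + 1)`. -/
structure SplittingSystem {V : Type} (G : SimpleGraph V) (d : ℕ) (r : ℕ → V → V → Prop)
    (s a b : ℕ → V) : Prop where
  conn : G.Connected
  finite_nbr : ∀ x, (G.neighborSet x).Finite
  nbr_card : ∀ x, (G.neighborSet x).ncard ≤ d
  equiv : ∀ n, Equivalence (r n)
  mono : ∀ {n x y}, r (n + 1) x y → r n x y
  nbr : ∀ {n x x' y}, r (n + 1) x x' → G.Adj x y → ∃ y', G.Adj x' y' ∧ r n y y'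
  reps : ∀ n, ∃ F : Finset V, ∀ x, ∃ e ∈ F, r n e x
  extend : ∀ {n x y}, r n x y → ¬ r n x (s n) → r (n + 1) x y
  two : ∀ {n x}, r n x (s n) → r (n + 1) x (a (n + 1)) ∨ r (n + 1) x (b (n + 1))
  a_s : ∀ n, r n (a (n + 1)) (s n)
  b_s : ∀ n, r n (b (n + 1)) (s n)
  ab : ∀ n, ¬ r n (a n) (b n)
  zero : ∀ x, r 0 x (a 0) ∨ r 0 x (b 0)
  a_adj : ∀ n, ∃ y, G.Adj (a (n + 1)) y ∧ r n y (a n)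
  b_adj : ∀ n, ∃ y, G.Adj (b (n + 1)) y ∧ r n y (b n)

/-- `y` lies outside the classes of `s n`, `a n` and `b n`. -/
def Generic {V : Type} (r : ℕ → V → V → Prop) (s a b : ℕ → V) (n : ℕ) (y : V) : Prop :=
  ¬ r n y (s n) ∧ ¬ r n y (a n) ∧ ¬ r n y (b n)

/-- The vertices from which a vertex satisfying `P` can be reached in at most `R` steps. -/
def Near {V : Type} (G : SimpleGraph V) (P : V → Prop) : ℕ → V → Prop
  | 0, x => P x
  | R + 1, x => Near G P R x ∨ ∃ y, G.Adj x y ∧ Near G P R y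

/-- A coherent sequence of nonempty unions of classes: a nonempty subsystem closed under
passing to neighbors. -/
structure Core {V : Type} (G : SimpleGraph V) (r : ℕ → V → V → Prop) (q : ℕ → V → Prop) :
    Prop where
  congr : ∀ {n x y}, r n x y → q n x → q n y
  down : ∀ {n x}, q (n + 1) x → q n x
  nbr : ∀ {n x y}, q (n + 1) x → G.Adj x y → q n y
  lift : ∀ {n x}, q n x → ∃ y, r n x y ∧ q (n + 1) y
  nonempty : ∀ n, ∃ x, q n x

/-- No vertex of the core sees three distinct classes other than its own. -/
def StarFree {V : Type} (G : SimpleGraph V) (r : ℕ → V → V → Prop) (q : ℕ → V → Prop) :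
    Prop :=
  ∀ n x y₁ y₂ y₃, q (n + 1) x → G.Adj x y₁ → G.Adj x y₂ → G.Adj x y₃ →
    ¬ r n y₁ y₂ → ¬ r n y₁ y₃ → ¬ r n y₂ y₃ →
    ¬ r n y₁ x → ¬ r n y₂ x → ¬ r n y₃ x → False

theorem forall_of_adj_closed {V : Type} {G : SimpleGraph V} (hG : G.Connected) {P : V → Prop}
    {x : V} (hx : P x) (hP : ∀ u v, P u → G.Adj u v → P v) (z : V) : P z := by
  obtain ⟨w⟩ := hG.preconnected x z
  induction w with
  | nil => exact hx
  | cons h _ ih => exact ih (hP _ _ hx h)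

namespace SplittingSystem

variable {V : Type} {G : SimpleGraph V} {d : ℕ} {r : ℕ → V → V → Prop} {s a b : ℕ → V}
  {q : ℕ → V → Prop}

theorem refl (h : SplittingSystem G d r s a b) (n : ℕ) (x : V) : r n x x := (h.equiv n).refl x

theorem symm (h : SplittingSystem G d r s a b) {n : ℕ} {x y : V} : r n x y → r n y x :=
  (h.equiv n).symm

theorem trans (h : SplittingSystem G d r s a b) {n : ℕ} {x y z : V} :
    r n x y → r n y z → r n x z := (h.equiv n).trans

theorem mono_le (h : SplittingSystem G d r s a b) {m n : ℕ} (hmn : m ≤ n) {x y : V} :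
    r n x y → r m x y := by
  induction n, hmn using Nat.le_induction with
  | base => exact id
  | succ k _ ih => exact fun hr => ih (h.mono hr)

theorem swap (h : SplittingSystem G d r s a b) : SplittingSystem G d r s b a where
  conn := h.conn
  finite_nbr := h.finite_nbr
  nbr_card := h.nbr_card
  equiv := h.equiv
  mono := h.mono
  nbr := h.nbr
  reps := h.reps
  extend := h.extend
  two hx := (h.two hx).symm
  a_s := h.b_s
  b_s := h.a_s
  ab n hr := h.ab n (h.symm hr)
  zero x := (h.zero x).symm
  a_adj := h.b_adj
  b_adj := h.a_adj

theorem generic_swap {n : ℕ} {y : V} (hy : Generic r s a b n y) : Generic r s b a n y :=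
  ⟨hy.1, hy.2.2, hy.2.1⟩

theorem generic_congr (h : SplittingSystem G d r s a b) {n : ℕ} {y y' : V} (hr : r n y y')
    (hy : Generic r s a b n y) : Generic r s a b n y' :=
  ⟨fun hh => hy.1 (h.trans hr hh), fun hh => hy.2.1 (h.trans hr hh),
    fun hh => hy.2.2 (h.trans hr hh)⟩

theorem transfer (h : SplittingSystem G d r s a b) {n : ℕ} {x x' y : V} (hxx : r n x x')
    (hxy : G.Adj x y) (ha : ¬ r n y (a n)) (hb : ¬ r n y (b n)) :
    ∃ y', G.Adj x' y' ∧ r n y y' := by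
  cases n with
  | zero => exact ((h.zero y).elim ha hb).elim
  | succ k =>
    obtain ⟨y', hy', hr⟩ := h.nbr hxx hxy
    exact ⟨y', hy', h.extend hr fun hs => (h.two hs).elim ha hb⟩

theorem hit_a (h : SplittingSystem G d r s a b) {n : ℕ} {x y : V} (hyx : G.Adj y x)
    (hx : r n x (s n)) (hy : Generic r s a b n y) (hys : ¬ r (n + 1) y (s (n + 1))) :
    ∃ u, G.Adj y u ∧ r (n + 1) u (a (n + 1)) := by
  obtain ⟨y₁, hy₁, hr⟩ :=
    h.transfer (h.trans hx (h.symm (h.a_s n))) hyx.symm hy.2.1 hy.2.2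
  obtain ⟨u, hu, hur⟩ := h.nbr (h.symm (h.extend (h.extend hr hy.1) hys)) hy₁.symm
  exact ⟨u, hu, h.symm hur⟩

theorem hit_b (h : SplittingSystem G d r s a b) {n : ℕ} {x y : V} (hyx : G.Adj y x)
    (hx : r n x (s n)) (hy : Generic r s a b n y) (hys : ¬ r (n + 1) y (s (n + 1))) :
    ∃ u, G.Adj y u ∧ r (n + 1) u (b (n + 1)) :=
  h.swap.hit_a hyx hx (generic_swap hy) hys

theorem core_full (h : SplittingSystem G d r s a b) (hq : Core G r q) {n : ℕ}
    (ha : q n (a n)) (hb : q n (b n)) (z : V) : q n z := by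
  induction n generalizing z with
  | zero =>
    rcases h.zero z with hz | hz
    exacts [hq.congr (h.symm hz) ha, hq.congr (h.symm hz) hb]
  | succ n ih =>
    obtain ⟨u, hu, hur⟩ := h.a_adj n
    obtain ⟨v, hv, hvr⟩ := h.b_adj n
    obtain ⟨y, hy, hqy⟩ :=
      hq.lift (ih (hq.congr hur (hq.nbr ha hu)) (hq.congr hvr (hq.nbr hb hv)) z)
    by_cases hz : r n z (s n)
    · rcases h.two hz with hz | hz
      exacts [hq.congr (h.symm hz) ha, hq.congr (h.symm hz) hb]
    · exact hq.congr (h.symm (h.extend hy hz)) hqy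

theorem deficient_mono (h : SplittingSystem G d r s a b) (hq : Core G r q) {m n : ℕ}
    (hmn : m ≤ n) (hm : ¬ (q m (a m) ∧ q m (b m))) : ¬ (q n (a n) ∧ q n (b n)) := by
  induction n, hmn using Nat.le_induction with
  | base => exact hm
  | succ k _ ih =>
    rintro ⟨ha, hb⟩
    obtain ⟨u, hu, hur⟩ := h.a_adj k
    obtain ⟨v, hv, hvr⟩ := h.b_adj k
    exact ih ⟨hq.congr hur (hq.nbr ha hu), hq.congr hvr (hq.nbr hb hv)⟩

theorem core_extend (h : SplittingSystem G d r s a b) (hq : Core G r q) {n : ℕ} {z : V}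
    (hz : ¬ r n z (s n)) (hqz : q n z) : q (n + 1) z := by
  obtain ⟨y, hy, hqy⟩ := hq.lift hqz
  exact hq.congr (h.symm (h.extend hy hz)) hqy

theorem core_s (h : SplittingSystem G d r s a b) (hq : Core G r q) (n : ℕ) : q n (s n) := by
  by_contra hs
  obtain ⟨x, hx⟩ := hq.nonempty n
  refine hs (forall_of_adj_closed h.conn hx (fun u v hu huv => ?_) (s n))
  exact hq.nbr (h.core_extend hq (fun hr => hs (hq.congr hr hu)) hu) huv

theorem generic_class_of_deficient (h : SplittingSystem G d r s a b) (hq : Core G r q) {n : ℕ}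
    (hdef : ¬ (q (n + 1) (a (n + 1)) ∧ q (n + 1) (b (n + 1)))) {x y : V} (hxy : G.Adj x y)
    (hx : r n x (s n)) (hy : Generic r s a b n y) : r n y (s (n + 1)) := by
  by_contra hne
  obtain ⟨x', hx', hqx'⟩ := hq.lift (h.core_s hq n)
  obtain ⟨y', hy', hr⟩ := h.transfer (h.trans hx hx') hxy hy.2.1 hy.2.2
  have hg := h.generic_congr hr hy
  have hs : ¬ r (n + 1) y' (s (n + 1)) := fun hh => hne (h.trans hr (h.mono hh))
  have hqy : q (n + 2) y' := h.core_extend hq hs (h.core_extend hq hg.1 (hq.nbr hqx' hy'))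
  obtain ⟨u, hu, hur⟩ := h.hit_a hy'.symm (h.symm hx') hg hs
  obtain ⟨v, hv, hvr⟩ := h.hit_b hy'.symm (h.symm hx') hg hs
  exact hdef ⟨hq.congr hur (hq.nbr hqy hu), hq.congr hvr (hq.nbr hqy hv)⟩

theorem generic_unique_of_a (h : SplittingSystem G d r s a b) (hst : StarFree G r q) {n : ℕ}
    (hqa : q (n + 1) (a (n + 1))) (has : ¬ r n (a n) (s n)) {x x' y y' : V}
    (hxy : G.Adj x y) (hxy' : G.Adj x' y') (hx : r n x (s n)) (hx' : r n x' (s n))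
    (hy : Generic r s a b n y) (hy' : Generic r s a b n y') : r n y y' := by
  by_contra hne
  have has' := h.symm (h.a_s n)
  obtain ⟨z, hz, hzr⟩ := h.transfer (h.trans hx has') hxy hy.2.1 hy.2.2
  obtain ⟨z', hz', hzr'⟩ := h.transfer (h.trans hx' has') hxy' hy'.2.1 hy'.2.2
  obtain ⟨w, hw, hwr⟩ := h.a_adj n
  have hg := h.generic_congr hzr hy
  have hg' := h.generic_congr hzr' hy'
  exact hst n _ z z' w hqa hz hz' hw
    (fun hh => hne (h.trans hzr (h.trans hh (h.symm hzr'))))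
    (fun hh => hg.2.1 (h.trans hh hwr)) (fun hh => hg'.2.1 (h.trans hh hwr))
    (fun hh => hg.1 (h.trans hh (h.a_s n))) (fun hh => hg'.1 (h.trans hh (h.a_s n)))
    (fun hh => has (h.trans (h.symm hwr) (h.trans hh (h.a_s n))))

theorem generic_unique (h : SplittingSystem G d r s a b) (hq : Core G r q)
    (hst : StarFree G r q) {n : ℕ} {x x' y y' : V}
    (hxy : G.Adj x y) (hxy' : G.Adj x' y') (hx : r n x (s n)) (hx' : r n x' (s n))
    (hy : Generic r s a b n y) (hy' : Generic r s a b n y') : r n y y' := by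
  by_cases hdef : q (n + 1) (a (n + 1)) ∧ q (n + 1) (b (n + 1))
  · by_cases has : r n (a n) (s n)
    · refine h.swap.generic_unique_of_a hst hdef.2
        (fun hbs => h.ab n (h.trans has (h.symm hbs))) hxy hxy' hx hx'
        (generic_swap hy) (generic_swap hy')
    · exact h.generic_unique_of_a hst hdef.1 has hxy hxy' hx hx' hy hy'
  · exact h.trans (h.generic_class_of_deficient hq hdef hxy hx hy)
      (h.symm (h.generic_class_of_deficient hq hdef hxy' hx' hy'))

theorem no_generic_of_central_a (h : SplittingSystem G d r s a b) (hq : Core G r q)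
    (hst : StarFree G r q) {n : ℕ} (hfull : ∀ z, q (n + 1) z)
    (hsa : r (n + 1) (s (n + 1)) (a (n + 1))) {x y : V} (hxy : G.Adj x y)
    (hx : r n x (s n)) (hy : Generic r s a b n y) : False := by
  have hya : ¬ r (n + 1) y (a (n + 1)) := fun hh => hy.1 (h.trans (h.mono hh) (h.a_s n))
  have hyb : ¬ r (n + 1) y (b (n + 1)) := fun hh => hy.1 (h.trans (h.mono hh) (h.b_s n))
  have hys : ¬ r (n + 1) y (s (n + 1)) := fun hh => hya (h.trans hh hsa)
  have see_y : ∀ z, r n z (s n) → ∃ y', G.Adj z y' ∧ r (n + 1) y y' := fun z hz => by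
    obtain ⟨y', hy', hr⟩ := h.transfer (h.trans hx (h.symm hz)) hxy hy.2.1 hy.2.2
    exact ⟨y', hy', h.extend hr hy.1⟩
  obtain ⟨u, hu, hua⟩ := h.hit_a hxy.symm hx hy hys
  obtain ⟨v, hv, hvb⟩ := h.hit_b hxy.symm hx hy hys
  have key : ∀ z, r (n + 1) z (a (n + 1)) ∨ r (n + 1) z (b (n + 1)) ∨ r (n + 1) z y := by
    refine forall_of_adj_closed h.conn (x := y) (Or.inr (Or.inr (h.refl _ _))) ?_
    intro z w hz hzw
    by_contra! hw
    obtain ⟨hwa, hwb, hwy⟩ := hw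
    rcases hz with hz | hz | hz
    · obtain ⟨y', hy', hr⟩ := see_y z (h.trans (h.mono hz) (h.a_s n))
      have hzs := h.trans hz (h.symm hsa)
      exact hwy (h.symm (h.trans hr (h.generic_unique hq hst hy' hzw hzs hzs
        (h.generic_congr hr ⟨hys, hya, hyb⟩) ⟨fun hh => hwa (h.trans hh hsa), hwa, hwb⟩)))
    · obtain ⟨y', hy', hr⟩ := see_y z (h.trans (h.mono hz) (h.b_s n))
      have hzs : ¬ r (n + 1) z (s (n + 1)) := fun hh =>
        h.ab (n + 1) (h.trans (h.symm (h.trans hh hsa)) hz)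
      obtain ⟨t, ht, htb⟩ := h.b_adj (n + 1)
      have htz := h.trans htb (h.symm hz)
      obtain ⟨c, hc, hcr⟩ := h.nbr (h.extend htz fun hh => hzs (h.trans (h.symm htz) hh)) ht.symm
      have hca : r (n + 1) c (a (n + 1)) :=
        h.trans (h.symm hcr) (h.trans (h.b_s (n + 1)) hsa)
      exact hst (n + 1) z c y' w (h.core_extend hq hzs (hfull z)) hc hy' hzw
        (fun hh => hya (h.trans hr (h.trans (h.symm hh) hca)))
        (fun hh => hwa (h.trans (h.symm hh) hca))
        (fun hh => hwy (h.symm (h.trans hr hh)))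
        (fun hh => h.ab (n + 1) (h.trans (h.symm hca) (h.trans hh hz)))
        (fun hh => hyb (h.trans hr (h.trans hh hz)))
        (fun hh => hwb (h.trans hh hz))
    · have hzs : ¬ r (n + 1) z (s (n + 1)) := fun hh => hys (h.trans (h.symm hz) hh)
      have hyz := h.extend (h.symm hz) hys
      obtain ⟨u', hu', hur⟩ := h.nbr hyz hu
      obtain ⟨v', hv', hvr⟩ := h.nbr hyz hv
      have hua' := h.trans (h.symm hur) hua
      have hvb' := h.trans (h.symm hvr) hvb
      exact hst (n + 1) z u' v' w (h.core_extend hq hzs (hfull z)) hu' hv' hzw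
        (fun hh => h.ab (n + 1) (h.trans (h.symm hua') (h.trans hh hvb')))
        (fun hh => hwa (h.trans (h.symm hh) hua'))
        (fun hh => hwb (h.trans (h.symm hh) hvb'))
        (fun hh => hya (h.trans (h.symm hz) (h.trans (h.symm hh) hua')))
        (fun hh => hyb (h.trans (h.symm hz) (h.trans (h.symm hh) hvb')))
        (fun hh => hwy (h.trans hh hz))
  have key' : ∀ z, r n z (s n) ∨ r n z y := fun z => (key z).elim
    (fun hh => Or.inl (h.trans (h.mono hh) (h.a_s n))) fun hh => hh.elim
    (fun hh => Or.inl (h.trans (h.mono hh) (h.b_s n))) fun hh => Or.inr (h.mono hh)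
  have ha := (key' (a n)).resolve_right fun hh => hy.2.1 (h.symm hh)
  have hb := (key' (b n)).resolve_right fun hh => hy.2.2 (h.symm hh)
  exact h.ab n (h.trans ha (h.symm hb))

theorem no_generic_of_central (h : SplittingSystem G d r s a b) (hq : Core G r q)
    (hst : StarFree G r q) {n : ℕ} (hss : r n (s (n + 1)) (s n)) {x y : V} (hxy : G.Adj x y)
    (hx : r n x (s n)) (hy : Generic r s a b n y) : False := by
  by_cases hdef : q (n + 1) (a (n + 1)) ∧ q (n + 1) (b (n + 1))
  · have hfull := h.core_full hq hdef.1 hdef.2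
    rcases h.two hss with hsa | hsb
    · exact h.no_generic_of_central_a hq hst hfull hsa hxy hx hy
    · exact h.swap.no_generic_of_central_a hq hst hfull hsb hxy hx (generic_swap hy)
  · exact hy.1 (h.trans (h.generic_class_of_deficient hq hdef hxy hx hy) hss)

theorem exists_recurrent (h : SplittingSystem G d r s a b) {P : ℕ → V → Prop}
    (anti : ∀ {R R' w}, R ≤ R' → P R' w → P R w) (hP : ∀ R, ∃ w, P R w) (n : ℕ) :
    ∃ y, ∀ R, ∃ w, r n y w ∧ P R w := by
  by_contra! hno
  choose R hR using hno
  obtain ⟨F, hF⟩ := h.reps n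
  obtain ⟨w, hw⟩ := hP (F.sup R)
  obtain ⟨e, he, hew⟩ := hF w
  exact hR e w hew (anti (Finset.le_sup he) hw)

theorem equiv_of_three (h : SplittingSystem G d r s a b) {n : ℕ} {y₁ y₂ y₃ p p' : V}
    (h₁ : r n y₁ p ∨ r n y₁ p') (h₂ : r n y₂ p ∨ r n y₂ p') (h₃ : r n y₃ p ∨ r n y₃ p') :
    r n y₁ y₂ ∨ r n y₁ y₃ ∨ r n y₂ y₃ := by
  have key : ∀ {u v w : V}, r n u w → r n v w → r n u v := fun hu hv => h.trans hu (h.symm hv)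
  rcases h₁ with h₁ | h₁ <;> rcases h₂ with h₂ | h₂ <;> rcases h₃ with h₃ | h₃ <;>
    first
      | exact Or.inl (key h₁ h₂)
      | exact Or.inr (Or.inl (key h₁ h₃))
      | exact Or.inr (Or.inr (key h₂ h₃))

theorem near_mono {P : V → Prop} {R R' : ℕ} (hR : R ≤ R') {x : V} (hx : Near G P R x) :
    Near G P R' x := by
  induction R', hR using Nat.le_induction with
  | base => exact hx
  | succ k _ ih => exact Or.inl ih

theorem exists_deficient_core (h : SplittingSystem G d r s a b) {M : ℕ} {e : V}
    (hfar : ∀ R, ∃ x, ¬ Near G (r M e) R x) :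
    ∃ q, Core G r q ∧ ¬ (q M (a M) ∧ q M (b M)) := by
  have anti : ∀ {R R' w}, R ≤ R' → ¬ Near G (r M e) R' w → ¬ Near G (r M e) R w :=
    fun hR hw hw' => hw (near_mono hR hw')
  have hq : Core G r (fun n z => ∀ R, ∃ w, r n z w ∧ ¬ Near G (r M e) R w) :=
    { congr := fun hr hx R => by
        obtain ⟨w, hw, hn⟩ := hx R
        exact ⟨w, h.trans (h.symm hr) hw, hn⟩
      down := fun hx R => by
        obtain ⟨w, hw, hn⟩ := hx R
        exact ⟨w, h.mono hw, hn⟩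
      nbr := fun hx hxy R => by
        obtain ⟨w, hw, hn⟩ := hx (R + 1)
        obtain ⟨y', hy', hr⟩ := h.nbr hw hxy
        exact ⟨y', hr, fun hh => hn (Or.inr ⟨y', hy', hh⟩)⟩
      lift := fun {n x} hx => by
        obtain ⟨y, hy⟩ := h.exists_recurrent
          (P := fun R w => r n x w ∧ ¬ Near G (r M e) R w)
          (fun hR hw => ⟨hw.1, anti hR hw.2⟩) hx (n + 1)
        obtain ⟨w, hw, hxw, -⟩ := hy 0
        refine ⟨y, h.trans hxw (h.symm (h.mono hw)), fun R => ?_⟩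
        obtain ⟨w, hw, -, hn⟩ := hy R
        exact ⟨w, hw, hn⟩
      nonempty := h.exists_recurrent anti hfar }
  refine ⟨_, hq, fun hab => ?_⟩
  obtain ⟨w, hw, hn⟩ := h.core_full hq hab.1 hab.2 e 0
  exact hn hw

theorem core_down_le (hq : Core G r q) {m n : ℕ} (hmn : m ≤ n) {x : V} : q n x → q m x := by
  induction n, hmn using Nat.le_induction with
  | base => exact id
  | succ k _ ih => exact fun hx => ih (hq.down hx)

theorem core_lift_le (h : SplittingSystem G d r s a b) (hq : Core G r q) {m n : ℕ}
    (hmn : m ≤ n) {x : V} (hx : q m x) : ∃ y, r m x y ∧ q n y := by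
  induction n, hmn using Nat.le_induction with
  | base => exact ⟨x, h.refl _ _, hx⟩
  | succ k hk ih =>
    obtain ⟨y, hy, hqy⟩ := ih
    obtain ⟨z, hz, hqz⟩ := hq.lift hqy
    exact ⟨z, h.trans hy (h.mono_le hk hz), hqz⟩

theorem core_rigid (h : SplittingSystem G d r s a b) {n : ℕ} (hq : Core G r q)
    (hdef : ¬ (q (n + 1) (a (n + 1)) ∧ q (n + 1) (b (n + 1)))) {u v : V}
    (hu : q (n + 1) u) (hv : q (n + 1) v) (huv : r n u v) : r (n + 1) u v := by
  by_cases hs : r n u (s n)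
  · rcases h.two hs with hua | hub <;> rcases h.two (h.trans (h.symm huv) hs) with hva | hvb
    · exact h.trans hua (h.symm hva)
    · exact (hdef ⟨hq.congr hua hu, hq.congr hvb hv⟩).elim
    · exact (hdef ⟨hq.congr hva hv, hq.congr hub hu⟩).elim
    · exact h.trans hub (h.symm hvb)
  · exact h.extend huv hs

theorem nbr_of_special_of_deficient (h : SplittingSystem G d r s a b) (hq : Core G r q) {k : ℕ}
    (hdef : ¬ (q (k + 2) (a (k + 2)) ∧ q (k + 2) (b (k + 2)))) {x y : V} (hxy : G.Adj x y)
    (hx : r (k + 1) x (s (k + 1))) :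
    r (k + 1) y (s (k + 1)) ∨ r k y (s k) ∨ r (k + 1) y (s (k + 2)) := by
  by_contra! hno
  exact hno.2.2 (h.generic_class_of_deficient hq hdef hxy hx ⟨hno.1,
    fun hh => hno.2.1 (h.trans (h.mono hh) (h.a_s k)),
    fun hh => hno.2.1 (h.trans (h.mono hh) (h.b_s k))⟩)

theorem visited_of_deficient (h : SplittingSystem G d r s a b) (hq : Core G r q) {M : ℕ}
    (hdef : ∀ m ≥ M, ¬ (q m (a m) ∧ q m (b m))) {x : V} (hx : q (M + 1) x) (T : ℕ) :
    ∃ m ≥ T, r M x (s m) := by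
  set Vis : V → Prop := fun z => ∀ T, ∃ m ≥ T, r M z (s m) with hVis
  have vis_congr : ∀ {u v}, r M u v → Vis u → Vis v := fun huv hu T => by
    obtain ⟨m, hm, hr⟩ := hu T
    exact ⟨m, hm, h.trans (h.symm huv) hr⟩
  have vis_nbr : ∀ {u v}, Vis u → q (M + 1) u → G.Adj u v → Vis v := by
    intro u v hu hqu huv
    by_cases hvu : r M v u
    · exact vis_congr (h.symm hvu) hu
    intro T
    obtain ⟨m, hm, hum⟩ := hu (max T M + 1)
    obtain ⟨k, rfl⟩ : ∃ k, m = k + 1 := ⟨m - 1, by omega⟩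
    obtain ⟨s', hs', hqs'⟩ := hq.lift (h.core_s hq (k + 1))
    have hus : r M u s' := h.trans hum (h.mono_le (by omega) hs')
    obtain ⟨v', hv', hvv⟩ := h.nbr (h.core_rigid hq (hdef _ (by omega)) hqu
      (core_down_le hq (by omega) hqs') hus) huv
    rcases h.nbr_of_special_of_deficient hq (hdef _ (by omega)) hv' (h.symm hs') with hh | hh | hh
    · exact (hvu (h.trans hvv (h.trans (h.mono_le (by omega) hh) (h.symm hum)))).elim
    · exact ⟨k, by omega, h.trans hvv (h.mono_le (by omega) hh)⟩
    · exact ⟨k + 2, by omega, h.trans hvv (h.mono_le (by omega) hh)⟩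
  have vis_s : ∃ m ≥ M + 1, Vis (s m) := by
    obtain ⟨y, hy⟩ := h.exists_recurrent (P := fun R w => ∃ m ≥ R, w = s m)
      (fun hR hw => by
        obtain ⟨m, hm, rfl⟩ := hw
        exact ⟨m, le_trans hR hm, rfl⟩) (fun R => ⟨s R, R, le_rfl, rfl⟩) M
    have hvis : Vis y := fun T => by
      obtain ⟨_, hr, m, hm, rfl⟩ := hy T
      exact ⟨m, hm, hr⟩
    obtain ⟨m, hm, hr⟩ := hvis (M + 1)
    exact ⟨m, hm, vis_congr hr hvis⟩
  suffices hvx : Vis x from hvx T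
  by_contra hvx
  obtain ⟨m, hm, hvm⟩ := vis_s
  obtain ⟨y, hy, hqy⟩ := h.core_lift_le hq hm hx
  refine (forall_of_adj_closed h.conn (P := fun z => q m z ∧ ¬ Vis z) (x := y)
    ⟨hqy, fun hvy => hvx (vis_congr (h.symm (h.mono hy)) hvy)⟩ ?_ (s m)).2 hvm
  rintro u v ⟨hqu, hvu⟩ huv
  have hus : ¬ r m u (s m) := fun hh =>
    hvu (vis_congr (h.symm (h.mono_le (by omega) hh)) hvm)
  have hqv := hq.nbr (h.core_extend hq hus hqu) huv
  exact ⟨hqv, fun hvv => hvu (vis_nbr hvv (core_down_le hq hm hqv) huv.symm)⟩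

theorem starFree_of_deficient (h : SplittingSystem G d r s a b) (hq : Core G r q) {M : ℕ}
    (hdef : ¬ (q M (a M) ∧ q M (b M))) : StarFree G r q := by
  intro n x y₁ y₂ y₃ hx h₁ h₂ h₃ h₁₂ h₁₃ h₂₃ hx₁ hx₂ hx₃
  obtain ⟨N, hN, hMN⟩ : ∃ N, n + 1 ≤ N ∧ M ≤ N := ⟨max (n + 1) M, by omega, by omega⟩
  have hdef' : ∀ m ≥ N, ¬ (q m (a m) ∧ q m (b m)) := fun m hm =>
    h.deficient_mono hq (by omega) hdef
  obtain ⟨x', hxx', hx'⟩ := h.core_lift_le hq (show n + 1 ≤ N + 1 by omega) hx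
  obtain ⟨m, hm, hxm⟩ := h.visited_of_deficient hq hdef' hx' (N + 1)
  obtain ⟨k, rfl⟩ : ∃ k, m = k + 1 := ⟨m - 1, by omega⟩
  obtain ⟨s', hs', hqs'⟩ := hq.lift (h.core_s hq (k + 1))
  have hx's := h.core_rigid hq (hdef' _ (by omega)) hx' (core_down_le hq (by omega) hqs')
    (h.trans hxm (h.mono_le (by omega) hs'))
  have key : ∀ y, G.Adj x y → ¬ r n y x → r n y (s k) ∨ r n y (s (k + 2)) := by
    intro y hy hyx
    obtain ⟨y', hy', hr⟩ := h.nbr hxx' hy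
    obtain ⟨y'', hy'', hr'⟩ := h.nbr hx's hy'
    have hyy := h.trans hr (h.mono_le (by omega) hr')
    rcases h.nbr_of_special_of_deficient hq (hdef' _ (by omega)) hy'' (h.symm hs') with
      hh | hh | hh
    · refine (hyx (h.trans hyy (h.trans (h.mono_le (by omega) hh) ?_))).elim
      exact h.trans (h.symm (h.mono_le (by omega) hxm)) (h.symm (h.mono hxx'))
    · exact Or.inl (h.trans hyy (h.mono_le (by omega) hh))
    · exact Or.inr (h.trans hyy (h.mono_le (by omega) hh))
  rcases h.equiv_of_three (key y₁ h₁ hx₁) (key y₂ h₂ hx₂) (key y₃ h₃ hx₃) with hh | hh | hh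
  exacts [h₁₂ hh, h₁₃ hh, h₂₃ hh]

theorem exists_forall_nbrs_stable (h : SplittingSystem G d r s a b) (y : V) :
    ∃ T, ∀ m ≥ T, ∀ u v, G.Adj y u → G.Adj y v → r m u v → r (m + 1) u v := by
  have hfin : ((G.neighborSet y ×ˢ G.neighborSet y).Finite) :=
    (h.finite_nbr y).prod (h.finite_nbr y)
  have hev : ∀ p ∈ G.neighborSet y ×ˢ G.neighborSet y,
      ∀ᶠ m in Filter.atTop, r m p.1 p.2 → r (m + 1) p.1 p.2 := by
    intro p _
    by_cases hp : ∀ m, r m p.1 p.2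
    · exact Filter.Eventually.of_forall fun m _ => hp (m + 1)
    · push Not at hp
      obtain ⟨m₀, hm₀⟩ := hp
      filter_upwards [Filter.eventually_ge_atTop m₀] with m hm hr
      exact (hm₀ (h.mono_le hm hr)).elim
  obtain ⟨T, hT⟩ := Filter.eventually_atTop.1 ((Filter.eventually_all_finite hfin).2 hev)
  exact ⟨T, fun m hm u v hu hv => hT m hm (u, v) ⟨hu, hv⟩⟩

theorem nbr_of_special_of_stable (h : SplittingSystem G d r s a b) {k : ℕ} {x y : V}
    (hxy : G.Adj y x) (hx : r (k + 1) x (s (k + 1)))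
    (hst : ∀ u v, G.Adj y u → G.Adj y v → r (k + 1) u x → r (k + 1) v x → r (k + 2) u v) :
    r (k + 1) y (s (k + 1)) ∨ r k y (s k) ∨ r (k + 2) y (s (k + 2)) := by
  by_contra! hno
  have hg : Generic r s a b (k + 1) y := ⟨hno.1,
    fun hh => hno.2.1 (h.trans (h.mono hh) (h.a_s k)),
    fun hh => hno.2.1 (h.trans (h.mono hh) (h.b_s k))⟩
  obtain ⟨u, hu, hua⟩ := h.hit_a hxy hx hg hno.2.2
  obtain ⟨v, hv, hvb⟩ := h.hit_b hxy hx hg hno.2.2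
  refine h.ab (k + 2) (h.trans (h.symm hua) (h.trans (hst u v hu hv ?_ ?_) hvb))
  · exact h.trans (h.trans (h.mono hua) (h.a_s _)) (h.symm hx)
  · exact h.trans (h.trans (h.mono hvb) (h.b_s _)) (h.symm hx)

theorem equiv_of_not_special (h : SplittingSystem G d r s a b) {N : ℕ} {y y' : V}
    (hy : ∀ m ≥ N, ¬ r m y (s m)) (hr : r N y y') {m : ℕ} (hm : N ≤ m) : r m y y' := by
  induction m, hm using Nat.le_induction with
  | base => exact hr
  | succ k hk ih => exact h.extend ih (hy k hk)

theorem visited_of_near (h : SplittingSystem G d r s a b)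
    (hU : ∀ M e, ∃ R, ∀ x, Near G (r M e) R x) (M : ℕ) (e : V) :
    ∃ m ≥ M, ∃ z, r M e z ∧ r m z (s m) := by
  by_contra! hno
  have key : ∀ j, ∃ T, ∀ m ≥ T, ∀ x, Near G (r M e) j x → ¬ r m x (s m) := by
    intro j
    induction j with
    | zero => exact ⟨M, hno⟩
    | succ j ih =>
      obtain ⟨N, hN⟩ := ih
      suffices hT : ∃ T, ∀ y, Near G (r M e) j y → ∀ m ≥ T, ∀ x, G.Adj y x → ¬ r m x (s m) by
        obtain ⟨T, hT⟩ := hT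
        refine ⟨max N T, fun m hm x hx => ?_⟩
        rcases hx with hx | ⟨y, hxy, hy⟩
        · exact hN m (by omega) x hx
        · exact hT y hy m (by omega) x hxy.symm
      by_contra! hev
      obtain ⟨y₀, hy₀⟩ := h.exists_recurrent
        (P := fun T y => Near G (r M e) j y ∧ ∃ m ≥ T, ∃ x, G.Adj y x ∧ r m x (s m))
        (fun hR hw => by
          obtain ⟨hy, m, hm, hx⟩ := hw
          exact ⟨hy, m, le_trans hR hm, hx⟩)
        (fun T => by
          obtain ⟨y, hy, m, hm, hx⟩ := hev T
          exact ⟨y, hy, m, hm, hx⟩) N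
      obtain ⟨y, hy₀y, hy, -⟩ := hy₀ 0
      obtain ⟨T, hT⟩ := h.exists_forall_nbrs_stable y
      obtain ⟨y', hy₀y', hy', m, hm, x', hyx', hx'⟩ := hy₀ (max T N + 1)
      obtain ⟨k, rfl⟩ : ∃ k, m = k + 1 := ⟨m - 1, by omega⟩
      have hfix : ∀ m ≥ N, ¬ r m y (s m) := fun m hm => hN m hm y hy
      have hyy' := h.equiv_of_not_special hfix (h.trans (h.symm hy₀y) hy₀y')
        (show N ≤ k + 2 by omega)
      obtain ⟨x, hx, hxr⟩ := h.nbr (h.symm hyy') hyx'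
      have hxs := h.trans (h.symm hxr) hx'
      rcases h.nbr_of_special_of_stable hx hxs (fun u v hu hv hux hvx =>
        hT (k + 1) (by omega) u v hu hv (h.trans hux (h.symm hvx))) with hh | hh | hh
      exacts [hfix _ (by omega) hh, hfix _ (by omega) hh, hfix _ (by omega) hh]
  obtain ⟨R, hR⟩ := hU M e
  obtain ⟨T, hT⟩ := key R
  exact hT T le_rfl (s T) (hR _) (h.refl _ _)

/-- The `m`-classes of those neighbors of `y` which satisfy `W`. -/
def nbrClasses (G : SimpleGraph V) (r : ℕ → V → V → Prop) (W : V → Prop) (m : ℕ) (y : V) :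
    Set (Set V) :=
  (fun u => {w | r m u w}) '' {u | G.Adj y u ∧ W u}

theorem nbrs_finite (h : SplittingSystem G d r s a b) (W : V → Prop) (y : V) :
    {u | G.Adj y u ∧ W u}.Finite :=
  (h.finite_nbr y).subset fun _ hu => hu.1

theorem ncard_nbrClasses_le (h : SplittingSystem G d r s a b) (W : V → Prop) (m : ℕ) (y : V) :
    (nbrClasses G r W m y).ncard ≤ d :=
  (Set.ncard_image_le (h.nbrs_finite W y)).trans
    ((Set.ncard_le_ncard (fun _ hu => hu.1) (h.finite_nbr y)).trans (h.nbr_card y))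

theorem class_eq (h : SplittingSystem G d r s a b) {n : ℕ} {x y : V} (hr : r n x y) :
    {w | r n x w} = {w | r n y w} :=
  Set.ext fun _ => ⟨fun hw => h.trans (h.symm hr) hw, fun hw => h.trans hr hw⟩

theorem class_succ_image (h : SplittingSystem G d r s a b) (m : ℕ) (u : V) :
    {w | ∃ z ∈ {w | r (m + 1) u w}, r m z w} = {w | r m u w} :=
  Set.ext fun _ => ⟨fun ⟨_, hz, hw⟩ => h.trans (h.mono hz) hw, fun hw => ⟨u, h.refl _ _, hw⟩⟩

theorem ncard_nbrClasses_mono (h : SplittingSystem G d r s a b) (W : V → Prop) {m m' : ℕ}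
    (hm : m ≤ m') (y : V) : (nbrClasses G r W m y).ncard ≤ (nbrClasses G r W m' y).ncard := by
  induction m', hm using Nat.le_induction with
  | base => exact le_rfl
  | succ k _ ih =>
    have hfin : (nbrClasses G r W (k + 1) y).Finite := (h.nbrs_finite W y).image _
    refine ih.trans ((Set.ncard_le_ncard ?_ (hfin.image fun C => {w | ∃ z ∈ C, r k z w})).trans
      (Set.ncard_image_le hfin))
    rintro _ ⟨u, hu, rfl⟩
    exact ⟨_, ⟨u, hu, rfl⟩, h.class_succ_image k u⟩

theorem ncard_nbrClasses_lt (h : SplittingSystem G d r s a b) {W : V → Prop} {m : ℕ}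
    {y u v : V} (hu : G.Adj y u) (hv : G.Adj y v) (hWu : W u) (hWv : W v) (huv : r m u v)
    (hne : ¬ r (m + 1) u v) :
    (nbrClasses G r W m y).ncard < (nbrClasses G r W (m + 1) y).ncard := by
  have hfin : (nbrClasses G r W (m + 1) y).Finite := (h.nbrs_finite W y).image _
  have hmem : {w | r (m + 1) v w} ∈ nbrClasses G r W (m + 1) y := ⟨v, ⟨hv, hWv⟩, rfl⟩
  have hdiff := hfin.sdiff (t := {{w | r (m + 1) v w}})
  refine lt_of_le_of_lt ((Set.ncard_le_ncard ?_
    (hdiff.image fun C => {w | ∃ z ∈ C, r m z w})).trans (Set.ncard_image_le hdiff))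
    (Set.ncard_sdiff_singleton_lt_of_mem hmem hfin)
  rintro _ ⟨t, ht, rfl⟩
  by_cases htv : r (m + 1) t v
  · refine ⟨_, ⟨⟨u, ⟨hu, hWu⟩, rfl⟩, fun hh => ?_⟩, ?_⟩
    · have : u ∈ {w | r (m + 1) v w} := by
        rw [← Set.mem_singleton_iff.1 hh]; exact h.refl _ _
      exact hne (h.symm this)
    · exact (h.class_succ_image m u).trans (h.class_eq (h.trans huv (h.symm (h.mono htv))))
  · refine ⟨_, ⟨⟨t, ht, rfl⟩, fun hh => ?_⟩, h.class_succ_image m t⟩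
    have : t ∈ {w | r (m + 1) v w} := by
      rw [← Set.mem_singleton_iff.1 hh]; exact h.refl _ _
    exact htv (h.symm this)

theorem nbrClasses_congr (h : SplittingSystem G d r s a b) {M m : ℕ} (hM : M ≤ m) (e : V)
    {y y' : V} (hr : r (m + 1) y y') :
    nbrClasses G r (r M e) m y = nbrClasses G r (r M e) m y' := by
  have key : ∀ {y y' : V}, r (m + 1) y y' →
      nbrClasses G r (r M e) m y ⊆ nbrClasses G r (r M e) m y' := by
    rintro y y' hr _ ⟨u, ⟨hu, hue⟩, rfl⟩
    obtain ⟨u', hu', huu⟩ := h.nbr hr hu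
    exact ⟨u', ⟨hu', h.trans hue (h.mono_le hM huu)⟩, (h.class_eq huu).symm⟩
  exact (key hr).antisymm (key (h.symm hr))

/-- A class `M, e` always adjacent to the class of `c` can be refined so that a neighbor in the
class of `c` no longer distinguishes between its neighbors in the old class. -/
theorem exists_saturated (h : SplittingSystem G d r s a b) {M N : ℕ} {e c : V}
    (hc : ∀ z, r M e z → ∃ y, G.Adj z y ∧ r N c y) :
    ∃ M' e', M ≤ M' ∧ r M e e' ∧ ∀ z, r M' e' z → ∃ y, G.Adj z y ∧ r N c y ∧
      ∀ m ≥ M', ∀ u v, G.Adj y u → G.Adj y v → r M e u → r M e v → r m u v →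
        r (m + 1) u v := by
  set K : Set ℕ := {k | ∃ y m, M ≤ m ∧ r N c y ∧ (∃ w, G.Adj y w ∧ r M e w) ∧
    (nbrClasses G r (r M e) m y).ncard = k} with hK
  have hbdd : BddAbove K := ⟨d, by
    rintro _ ⟨y, m, -, -, -, rfl⟩
    exact h.ncard_nbrClasses_le _ m y⟩
  have hne : K.Nonempty := by
    obtain ⟨y, hy, hcy⟩ := hc e (h.refl _ _)
    exact ⟨_, y, M, le_rfl, hcy, ⟨e, hy.symm, h.refl _ _⟩, rfl⟩
  obtain ⟨y₀, m₀, hm₀, hcy₀, ⟨e', he', hee'⟩, hmax⟩ := Nat.sSup_mem hne hbdd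
  refine ⟨m₀ + N + 2, e', by omega, hee', fun z hz => ?_⟩
  obtain ⟨y, hy, hyr⟩ := h.nbr hz he'.symm
  have hcy := h.trans hcy₀ (h.mono_le (by omega) hyr)
  refine ⟨y, hy, hcy, fun m hm u v hu hv heu hev huv => ?_⟩
  by_contra hsplit
  have hlt := h.ncard_nbrClasses_lt (W := r M e) hu hv heu hev huv hsplit
  have hmono := h.ncard_nbrClasses_mono (r M e) (show m₀ ≤ m by omega) y
  have heq := h.nbrClasses_congr hm₀ e (h.mono_le (show m₀ + 1 ≤ m₀ + N + 1 by omega) hyr)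
  have hle := le_csSup hbdd (show _ ∈ K from ⟨y, m + 1, by omega, hcy,
    ⟨z, hy.symm, h.trans hee' (h.mono_le (by omega) hz)⟩, rfl⟩)
  rw [← hmax, heq] at hle
  omega

theorem starFree_of_near (h : SplittingSystem G d r s a b)
    (hU : ∀ M e, ∃ R, ∀ x, Near G (r M e) R x) : StarFree G r fun _ _ => True := by
  intro n x y₁ y₂ y₃ _ h₁ h₂ h₃ h₁₂ h₁₃ h₂₃ hx₁ hx₂ hx₃
  have hadj : ∀ {y}, G.Adj x y → ∀ z, r (n + 1) x z → ∃ y', G.Adj z y' ∧ r n y y' :=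
    fun hy z hz => h.nbr hz hy
  obtain ⟨M₁, e₁, hM₁, he₁, hsat₁⟩ := h.exists_saturated (hadj h₁)
  obtain ⟨M₂, e₂, hM₂, he₂, hsat₂⟩ := h.exists_saturated (M := M₁) (e := e₁)
    (fun z hz => hadj h₂ z (h.trans he₁ (h.mono_le hM₁ hz)))
  have he₁₂ := h.trans he₁ (h.mono_le hM₁ he₂)
  obtain ⟨M₃, e₃, hM₃, he₃, hsat₃⟩ := h.exists_saturated (M := M₂) (e := e₂)
    (fun z hz => hadj h₃ z (h.trans he₁₂ (h.mono_le (by omega) hz)))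
  obtain ⟨m, hm, z, hz₃, hzs⟩ := h.visited_of_near hU M₃ e₃
  obtain ⟨k, rfl⟩ : ∃ k, m = k + 1 := ⟨m - 1, by omega⟩
  have hz₂ : r M₂ e₂ z := h.trans he₃ (h.mono_le hM₃ hz₃)
  have hz₁ : r M₁ e₁ z := h.trans he₂ (h.mono_le hM₂ hz₂)
  have hz₀ : r (n + 1) x z := h.trans he₁ (h.mono_le hM₁ hz₁)
  have key : ∀ {M e y y'}, M ≤ k + 1 → r M e z → ¬ r n y x → G.Adj z y' → r n y y' →
      (∀ u v, G.Adj y' u → G.Adj y' v → r M e u → r M e v → r (k + 1) u v → r (k + 2) u v) →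
      r n y (s k) ∨ r n y (s (k + 2)) := by
    intro M e y y' hM hez hyx hzy hyy hst
    rcases h.nbr_of_special_of_stable hzy.symm hzs (fun u v hu hv hux hvx =>
      hst u v hu hv (h.trans hez (h.symm (h.mono_le hM hux)))
        (h.trans hez (h.symm (h.mono_le hM hvx))) (h.trans hux (h.symm hvx))) with hh | hh | hh
    · refine (hyx (h.trans hyy (h.trans (h.mono_le (by omega) hh) ?_))).elim
      exact h.trans (h.symm (h.mono_le (by omega) hzs)) (h.symm (h.mono hz₀))
    · exact Or.inl (h.trans hyy (h.mono_le (by omega) hh))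
    · exact Or.inr (h.trans hyy (h.mono_le (by omega) hh))
  obtain ⟨y₁', hy₁', hr₁, hst₁⟩ := hsat₁ z hz₁
  obtain ⟨y₂', hy₂', hr₂, hst₂⟩ := hsat₂ z hz₂
  obtain ⟨y₃', hy₃', hr₃, hst₃⟩ := hsat₃ z hz₃
  rcases h.equiv_of_three
    (key (by omega) hz₀ hx₁ hy₁' hr₁ (hst₁ (k + 1) (by omega)))
    (key (by omega) hz₁ hx₂ hy₂' hr₂ (hst₂ (k + 1) (by omega)))
    (key (by omega) hz₂ hx₃ hy₃' hr₃ (hst₃ (k + 1) (by omega))) with hh | hh | hh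
  exacts [h₁₂ hh, h₁₃ hh, h₂₃ hh]

theorem exists_starFree_core (h : SplittingSystem G d r s a b) :
    ∃ q, Core G r q ∧ StarFree G r q := by
  by_cases hU : ∀ M e, ∃ R, ∀ x, Near G (r M e) R x
  · exact ⟨fun _ _ => True, ⟨fun _ _ => trivial, fun _ => trivial, fun _ _ => trivial,
      fun {_ x} _ => ⟨x, h.refl _ _, trivial⟩, fun n => ⟨s n, trivial⟩⟩, h.starFree_of_near hU⟩
  · push Not at hU
    obtain ⟨M, e, hfar⟩ := hU
    obtain ⟨q, hq, hdef⟩ := h.exists_deficient_core hfar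
    exact ⟨q, hq, h.starFree_of_deficient hq hdef⟩

end SplittingSystem

section Balls

variable {V α : Type} {G : SimpleGraph V} {φ : V → α}

theorem ballEquiv_equivalence (G : SimpleGraph V) (φ : V → α) (n : ℕ) :
    Equivalence (BallEquiv G φ n) where
  refl _ := ⟨Equiv.refl _, fun _ _ => Iff.rfl, fun _ => rfl, rfl⟩
  symm := by
    rintro x y ⟨f, hadj, hcol, hc⟩
    refine ⟨f.symm, fun u v => ?_, fun u => ?_, ?_⟩
    · rw [hadj, f.apply_symm_apply, f.apply_symm_apply]
    · rw [← hcol, f.apply_symm_apply]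
    · have : f.symm ⟨y, by simp⟩ = ⟨x, by simp⟩ := f.symm_apply_eq.2 (Subtype.ext hc.symm)
      exact congrArg Subtype.val this
  trans := by
    rintro x y z ⟨f, hadj, hcol, hc⟩ ⟨g, hadj', hcol', hc'⟩
    refine ⟨f.trans g, fun u v => (hadj u v).trans (hadj' _ _),
      fun u => (hcol' _).trans (hcol u), ?_⟩
    exact (congrArg (fun t => (g t).1) (Subtype.ext hc)).trans hc'

theorem ballClass_eq_iff {n : ℕ} {x y : V} :
    ballClass G φ n x = ballClass G φ n y ↔ BallEquiv G φ n x y := by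
  have h := ballEquiv_equivalence G φ n
  constructor
  · intro hxy
    have : y ∈ ballClass G φ n x := hxy ▸ h.refl y
    exact this
  · exact fun hxy => Set.ext fun z => ⟨fun hz => h.trans (h.symm hxy) hz, fun hz => h.trans hxy hz⟩

theorem exists_adj_dist_le (hG : G.Connected) {u w : V} {k : ℕ} (hk : G.dist u w = k + 1) :
    ∃ v, G.Adj w v ∧ G.dist u v ≤ k := by
  obtain ⟨p, hp⟩ := hG.exists_walk_length_eq_dist w u
  rw [SimpleGraph.dist_comm, hk] at hp
  cases p with
  | nil => simp at hp
  | @cons _ v _ hwv p =>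
    rw [SimpleGraph.Walk.length_cons] at hp
    exact ⟨v, hwv, SimpleGraph.dist_comm (G := G) ▸ (SimpleGraph.dist_le p).trans (by omega)⟩

theorem dist_map_le (hG : G.Connected) {x x' : V} {R : ℕ}
    (f : {z : V // G.dist x z ≤ R} → {z : V // G.dist x' z ≤ R})
    (hf : ∀ u v, G.Adj u.1 v.1 → G.Adj (f u).1 (f v).1) {m : ℕ}
    (y : {z : V // G.dist x z ≤ R}) (hy : G.dist x y.1 + m ≤ R)
    (w : {z : V // G.dist x z ≤ R}) (hw : G.dist y.1 w.1 ≤ m) :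
    G.dist (f y).1 (f w).1 ≤ G.dist y.1 w.1 := by
  induction hk : G.dist y.1 w.1 generalizing w with
  | zero =>
    have : y = w := Subtype.ext (hG.dist_eq_zero_iff.1 hk)
    rw [this, SimpleGraph.dist_self]
  | succ k ih =>
    obtain ⟨v, hwv, hvk⟩ := exists_adj_dist_le hG hk
    have h1 : G.dist v w.1 = 1 := SimpleGraph.dist_eq_one_iff_adj.2 hwv.symm
    have htri := hG.dist_triangle (u := y.1) (v := v) (w := w.1)
    have hxv := hG.dist_triangle (u := x) (v := y.1) (w := v)
    have hle := ih ⟨v, by omega⟩ (by show G.dist y.1 v ≤ m; omega)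
      (by show G.dist y.1 v = k; omega)
    have h1' := SimpleGraph.dist_eq_one_iff_adj.2 (hf ⟨v, by omega⟩ w hwv.symm)
    have := hG.dist_triangle (u := (f y).1) (v := (f ⟨v, by omega⟩).1) (w := (f w).1)
    omega

theorem ballEquiv_restrict (hG : G.Connected) {x x' : V} {R m : ℕ}
    (f : {z : V // G.dist x z ≤ R} ≃ {z : V // G.dist x' z ≤ R})
    (hadj : ∀ u v : {z : V // G.dist x z ≤ R}, G.Adj u.1 v.1 ↔ G.Adj (f u).1 (f v).1)
    (hcol : ∀ u, φ (f u).1 = φ u.1)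
    (hc : (f ⟨x, by rw [SimpleGraph.dist_self]; exact Nat.zero_le R⟩).1 = x')
    (y : {z : V // G.dist x z ≤ R}) (hy : G.dist x y.1 + m ≤ R) :
    BallEquiv G φ m y.1 (f y).1 := by
  have hadj' : ∀ u v, G.Adj u.1 v.1 → G.Adj (f.symm u).1 (f.symm v).1 := fun u v huv => by
    rw [hadj, f.apply_symm_apply, f.apply_symm_apply]
    exact huv
  have hfy : G.dist x' (f y).1 + m ≤ R := by
    have := dist_map_le hG f (fun u v => (hadj u v).1) (m := R)
      ⟨x, by rw [SimpleGraph.dist_self]; exact Nat.zero_le R⟩ (by simp) y y.2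
    rw [hc] at this
    exact (Nat.add_le_add_right this m).trans hy
  have hball : ∀ {w}, G.dist y.1 w ≤ m → G.dist x w ≤ R := fun {w} hw => by
    have := hG.dist_triangle (u := x) (v := y.1) (w := w)
    omega
  have hball' : ∀ {w}, G.dist (f y).1 w ≤ m → G.dist x' w ≤ R := fun {w} hw => by
    have := hG.dist_triangle (u := x') (v := (f y).1) (w := w)
    omega
  refine ⟨{ toFun := fun w => ⟨(f ⟨w.1, hball w.2⟩).1, ?_⟩
            invFun := fun w => ⟨(f.symm ⟨w.1, hball' w.2⟩).1, ?_⟩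
            left_inv := fun w => ?_
            right_inv := fun w => ?_ }, fun u v => ?_, fun u => ?_, ?_⟩
  · exact (dist_map_le hG f (fun u v => (hadj u v).1) y hy ⟨w.1, hball w.2⟩ w.2).trans w.2
  · have := dist_map_le hG f.symm hadj' (f y) hfy ⟨w.1, hball' w.2⟩ w.2
    rw [f.symm_apply_apply] at this
    exact this.trans w.2
  · simp
  · simp
  · exact hadj ⟨u.1, hball u.2⟩ ⟨v.1, hball v.2⟩
  · exact hcol ⟨u.1, hball u.2⟩
  · rfl

theorem ballEquiv_mono (hG : G.Connected) {n : ℕ} {x y : V} (h : BallEquiv G φ (n + 1) x y) :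
    BallEquiv G φ n x y := by
  obtain ⟨f, hadj, hcol, hc⟩ := h
  have := ballEquiv_restrict hG f hadj hcol hc (m := n)
    ⟨x, by rw [SimpleGraph.dist_self]; exact Nat.zero_le _⟩ (by simp)
  rwa [hc] at this

theorem ballEquiv_nbr (hG : G.Connected) {n : ℕ} {x x' y : V}
    (h : BallEquiv G φ (n + 1) x x') (hxy : G.Adj x y) :
    ∃ y', G.Adj x' y' ∧ BallEquiv G φ n y y' := by
  obtain ⟨f, hadj, hcol, hc⟩ := h
  have hd := SimpleGraph.dist_eq_one_iff_adj.2 hxy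
  refine ⟨(f ⟨y, by omega⟩).1, ?_,
    ballEquiv_restrict hG f hadj hcol hc ⟨y, by omega⟩ (by simp only [hd]; omega)⟩
  have := (hadj ⟨x, by simp⟩ ⟨y, by omega⟩).1 hxy
  rwa [hc] at this

theorem ballClasses_finite (hSt : IsSturmian G φ) (n : ℕ) : (ballClasses G φ n).Finite :=
  Set.finite_of_ncard_ne_zero (by rw [hSt n]; omega)

theorem exists_class_representatives (hSt : IsSturmian G φ) (n : ℕ) :
    ∃ F : Finset V, ∀ x, ∃ e ∈ F, BallEquiv G φ n e x := by
  have hfin := ballClasses_finite hSt n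
  have hrep : ∀ C : hfin.toFinset, ∃ x, C.1 = ballClass G φ n x :=
    fun C => hfin.mem_toFinset.1 C.2
  choose rep hrep using hrep
  refine ⟨Finset.univ.image rep, fun x => ?_⟩
  have hx : ballClass G φ n x ∈ hfin.toFinset := hfin.mem_toFinset.2 ⟨x, rfl⟩
  exact ⟨_, Finset.mem_image_of_mem rep (Finset.mem_univ ⟨_, hx⟩),
    ballClass_eq_iff.1 (hrep ⟨_, hx⟩).symm⟩

/-- Sturmian complexity leaves no room for two of the `(n + 1)`-classes to be redundant for
covering all `n`-classes. -/
theorem sturmian_no_two_redundant (hG : G.Connected) (hSt : IsSturmian G φ) {n : ℕ} {p p' : V}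
    (hp : ¬ BallEquiv G φ (n + 1) p p')
    (hcov : ∀ w, ∃ w', BallEquiv G φ n w w' ∧ ¬ BallEquiv G φ (n + 1) w' p ∧
      ¬ BallEquiv G φ (n + 1) w' p') : False := by
  have hfin := ballClasses_finite hSt (n + 1)
  set P : Set (Set V) := {ballClass G φ (n + 1) p, ballClass G φ (n + 1) p'} with hP
  have hPcard : P.ncard = 2 := Set.ncard_pair fun hh => hp (ballClass_eq_iff.1 hh)
  have hPsub : P ⊆ ballClasses G φ (n + 1) := by
    rintro _ (rfl | rfl)
    exacts [⟨p, rfl⟩, ⟨p', rfl⟩]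
  have hPfin : P.Finite := hfin.subset hPsub
  have hcard := Set.ncard_sdiff_add_ncard_of_subset hPsub hfin
  rw [hSt (n + 1), hPcard] at hcard
  have hsub : ballClasses G φ n ⊆
      (fun C => {y | ∃ z ∈ C, BallEquiv G φ n z y}) '' (ballClasses G φ (n + 1) \ P) := by
    have he := ballEquiv_equivalence G φ n
    rintro _ ⟨w, rfl⟩
    obtain ⟨w', hw, hw₁, hw₂⟩ := hcov w
    refine ⟨ballClass G φ (n + 1) w', ⟨⟨w', rfl⟩, ?_⟩, ?_⟩
    · rintro (hh | hh)
      exacts [hw₁ (ballClass_eq_iff.1 hh), hw₂ (ballClass_eq_iff.1 hh)]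
    · refine Set.ext fun y => ⟨?_, fun hy =>
        ⟨w', (ballEquiv_equivalence G φ _).refl w', he.trans (he.symm hw) hy⟩⟩
      rintro ⟨z, hz, hzy⟩
      exact he.trans hw (he.trans (ballEquiv_mono hG hz) hzy)
  have hle := (Set.ncard_le_ncard hsub ((hfin.sdiff).image _)).trans
    (Set.ncard_image_le hfin.sdiff)
  rw [hSt n] at hle
  omega

theorem sturmian_split_unique (hG : G.Connected) (hSt : IsSturmian G φ) {n : ℕ} {p q p' q' : V}
    (hpq : BallEquiv G φ n p q) (hpq' : ¬ BallEquiv G φ (n + 1) p q)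
    (hp : BallEquiv G φ n p' q') (hp' : ¬ BallEquiv G φ (n + 1) p' q') :
    BallEquiv G φ n p p' := by
  by_contra hne
  have e := ballEquiv_equivalence G φ n
  refine sturmian_no_two_redundant hG hSt (n := n) (p := q) (p' := q')
    (fun hh => hne (e.trans hpq (e.trans (ballEquiv_mono hG hh) (e.symm hp)))) fun w => ?_
  by_cases hw : BallEquiv G φ (n + 1) w q
  · exact ⟨p, e.trans (ballEquiv_mono hG hw) (e.symm hpq), hpq',
      fun hh => hne (e.trans (ballEquiv_mono hG hh) (e.symm hp))⟩
  by_cases hw' : BallEquiv G φ (n + 1) w q'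
  · exact ⟨p', e.trans (ballEquiv_mono hG hw') (e.symm hp),
      fun hh => hne (e.trans hpq (e.symm (ballEquiv_mono hG hh))), hp'⟩
  exact ⟨w, e.refl w, hw, hw'⟩

theorem sturmian_split_two (hG : G.Connected) (hSt : IsSturmian G φ) {n : ℕ} {x p q : V}
    (hpq : BallEquiv G φ n p q) (hpq' : ¬ BallEquiv G φ (n + 1) p q)
    (hx : BallEquiv G φ n x p) : BallEquiv G φ (n + 1) x p ∨ BallEquiv G φ (n + 1) x q := by
  by_contra! hno
  have e := ballEquiv_equivalence G φ n
  have e' := ballEquiv_equivalence G φ (n + 1)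
  refine sturmian_no_two_redundant hG hSt hno.1 fun w => ?_
  by_cases hw : BallEquiv G φ n w p
  · exact ⟨q, e.trans hw hpq, fun hh => hno.2 (e'.symm hh), fun hh => hpq' (e'.symm hh)⟩
  · exact ⟨w, e.refl w, fun hh => hw (e.trans (ballEquiv_mono hG hh) hx),
      fun hh => hw (ballEquiv_mono hG hh)⟩

theorem sturmian_zero (hSt : IsSturmian G φ) {p q : V} (hpq : ¬ BallEquiv G φ 0 p q) (x : V) :
    BallEquiv G φ 0 x p ∨ BallEquiv G φ 0 x q := by
  by_contra! hno
  have hcard : ({ballClass G φ 0 x, ballClass G φ 0 p, ballClass G φ 0 q} : Set (Set V)).ncard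
      = 3 := by
    rw [Set.ncard_eq_three]
    exact ⟨_, _, _, fun hh => hno.1 (ballClass_eq_iff.1 hh),
      fun hh => hno.2 (ballClass_eq_iff.1 hh), fun hh => hpq (ballClass_eq_iff.1 hh), rfl⟩
  have hle := Set.ncard_le_ncard (s := {ballClass G φ 0 x, ballClass G φ 0 p, ballClass G φ 0 q})
    (t := ballClasses G φ 0) (by
      rintro _ (rfl | rfl | rfl)
      exacts [⟨x, rfl⟩, ⟨p, rfl⟩, ⟨q, rfl⟩]) (ballClasses_finite hSt 0)
  rw [hcard, hSt 0] at hle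
  omega

theorem ballEquiv_color {n : ℕ} {x y : V} (h : BallEquiv G φ n x y) : φ x = φ y := by
  obtain ⟨f, -, hcol, hc⟩ := h
  rw [← hc, hcol]

theorem mem_ballClass_self (n : ℕ) (x : V) : x ∈ ballClass G φ n x :=
  (ballEquiv_equivalence G φ n).refl x

theorem Labeling.splittingSystem {d : ℕ} (hd : 0 < d) (hT : IsRegularTree G d)
    (hSt : IsSturmian G φ) {a b : α} (hab : a ≠ b) (L : Labeling G φ a b) {s u v : ℕ → V}
    (hs : ∀ n, L.S n = ballClass G φ n (s n)) (hu : ∀ n, L.A n = ballClass G φ n (u n))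
    (hv : ∀ n, L.B n = ballClass G φ n (v n)) :
    SplittingSystem G d (BallEquiv G φ) s u v := by
  have hG := hT.isTree.1
  have e := ballEquiv_equivalence G φ
  have hus : ∀ n, BallEquiv G φ n (u (n + 1)) (s n) := fun n => by
    obtain ⟨x, -, hx, hx'⟩ := L.A_ext n
    rw [hs, ballClass_eq_iff] at hx
    rw [hu, ballClass_eq_iff] at hx'
    exact (e n).trans (ballEquiv_mono hG hx') ((e n).symm hx)
  have hvs : ∀ n, BallEquiv G φ n (v (n + 1)) (s n) := fun n => by
    obtain ⟨x, -, hx, hx'⟩ := L.B_ext n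
    rw [hs, ballClass_eq_iff] at hx
    rw [hv, ballClass_eq_iff] at hx'
    exact (e n).trans (ballEquiv_mono hG hx') ((e n).symm hx)
  have huv : ∀ n, ¬ BallEquiv G φ n (u n) (v n) := by
    rintro (_ | n) hh
    · obtain ⟨x, rfl, hx⟩ := L.A0_col
      obtain ⟨y, rfl, hy⟩ := L.B0_col
      rw [hu, ballClass_eq_iff] at hx
      rw [hv, ballClass_eq_iff] at hy
      exact hab ((ballEquiv_color hx).symm.trans ((ballEquiv_color hh).trans (ballEquiv_color hy)))
    · exact L.AB_ne n (by rw [hu, hv, ballClass_eq_iff]; exact hh)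
  have huv' : ∀ n, BallEquiv G φ n (u (n + 1)) (v (n + 1)) := fun n =>
    (e n).trans (hus n) ((e n).symm (hvs n))
  refine
    { conn := hG
      finite_nbr := fun x => Set.finite_of_ncard_pos (by rw [hT.regular]; exact hd)
      nbr_card := fun x => (hT.regular x).le
      equiv := e
      mono := ballEquiv_mono hG
      nbr := ballEquiv_nbr hG
      reps := exists_class_representatives hSt
      extend := fun {n x y} hxy hxs => ?_
      two := fun {n x} hx => sturmian_split_two hG hSt (huv' n) (huv (n + 1))
        ((e n).trans hx ((e n).symm (hus n)))
      a_s := hus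
      b_s := hvs
      ab := huv
      zero := sturmian_zero hSt (huv 0)
      a_adj := fun n => ?_
      b_adj := fun n => ?_ }
  · by_contra hne
    exact hxs ((e n).trans (sturmian_split_unique hG hSt hxy hne (huv' n) (huv (n + 1))) (hus n))
  · obtain ⟨y, hy, hyA⟩ := L.A_adj n (u (n + 1)) (by rw [hu]; exact mem_ballClass_self _ _)
    rw [hu] at hyA
    exact ⟨y, hy, (e n).symm hyA⟩
  · obtain ⟨y, hy, hyB⟩ := L.B_adj n (v (n + 1)) (by rw [hv]; exact mem_ballClass_self _ _)
    rw [hv] at hyB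
    exact ⟨y, hy, (e n).symm hyB⟩

end Balls

/-- Lemma 2.3: for a class `D` of `n`-balls different from
`A_n, B_n, S_n`: (1) if `S_n, D` can be adjacent then they are always adjacent;
(2) if moreover `D ≠ C_n` then `S_n ≠ C_n`; (3) apart from `S_n` itself, at most three
classes of `n`-balls can be adjacent to `S_n`. -/
theorem special_adjacency {V α : Type} (G : SimpleGraph V) (d : ℕ) (hd : 3 ≤ d)
    (hT : IsRegularTree G d) (φ : V → α) (hSt : IsSturmian G φ)
    (a b : α) (hab : a ≠ b) (L : Labeling G φ a b) (n : ℕ) :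
    (∀ D ∈ ballClasses G φ n, D ≠ L.A n → D ≠ L.B n → D ≠ L.S n →
      (CanAdj G (L.S n) D → AlwaysAdj G (L.S n) D) ∧
      (CanAdj G (L.S n) D → D ≠ L.C n → L.S n ≠ L.C n)) ∧
    (∃ D₁ D₂ D₃ : Set V, ∀ E ∈ ballClasses G φ n, E ≠ L.S n → CanAdj G (L.S n) E →
      E = D₁ ∨ E = D₂ ∨ E = D₃) := by
  choose s hs _ using L.S_special
  have hA : ∀ n, ∃ x, L.A n = ballClass G φ n x := by
    rintro (_ | n)
    · obtain ⟨x, -, hx⟩ := L.A0_col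
      exact ⟨x, hx⟩
    · obtain ⟨x, -, -, hx⟩ := L.A_ext n
      exact ⟨x, hx⟩
  have hB : ∀ n, ∃ x, L.B n = ballClass G φ n x := by
    rintro (_ | n)
    · obtain ⟨x, -, hx⟩ := L.B0_col
      exact ⟨x, hx⟩
    · obtain ⟨x, -, -, hx⟩ := L.B_ext n
      exact ⟨x, hx⟩
  choose u hu using hA
  choose v hv using hB
  have h := L.splittingSystem (by omega) hT hSt hab hs hu hv
  obtain ⟨q, hq, hst⟩ := h.exists_starFree_core
  have generic : ∀ {y}, ballClass G φ n y ≠ L.A n → ballClass G φ n y ≠ L.B n →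
      ballClass G φ n y ≠ L.S n → Generic (BallEquiv G φ) s u v n y := fun hyA hyB hyS =>
    ⟨fun hh => hyS (by rw [hs]; exact ballClass_eq_iff.2 hh),
      fun hh => hyA (by rw [hu]; exact ballClass_eq_iff.2 hh),
      fun hh => hyB (by rw [hv]; exact ballClass_eq_iff.2 hh)⟩
  have adj : ∀ {y}, CanAdj G (L.S n) (ballClass G φ n y) →
      ∃ x y', G.Adj x y' ∧ BallEquiv G φ n x (s n) ∧ BallEquiv G φ n y y' := by
    rintro y ⟨x, hx, y', hy', hxy⟩
    rw [hs] at hx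
    exact ⟨x, y', hxy, h.symm hx, hy'⟩
  refine ⟨?_, ?_⟩
  · rintro _ ⟨y₀, rfl⟩ hDA hDB hDS
    have hy₀ := generic hDA hDB hDS
    refine ⟨fun hcan => ?_, fun hcan _ hSC => ?_⟩ <;> obtain ⟨x, y, hxy, hx, hy⟩ := adj hcan <;>
      have hgy := h.generic_congr hy hy₀
    · refine ⟨fun x' hx' => ?_, fun y' hy' => ?_⟩
      · rw [hs] at hx'
        obtain ⟨y', hy', hr⟩ := h.transfer (h.trans hx hx') hxy hgy.2.1 hgy.2.2
        exact ⟨y', hy', h.trans hy hr⟩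
      · obtain ⟨x', hx', hr⟩ := h.nbr (h.extend (h.trans (h.symm hy) hy') hgy.1) hxy.symm
        exact ⟨x', hx', by rw [hs]; exact h.trans (h.symm hx) hr⟩
    · obtain ⟨c, -, hc, hc'⟩ := L.C_central n
      rw [hs, ballClass_eq_iff] at hc
      rw [← hSC, hs, ballClass_eq_iff] at hc'
      exact h.no_generic_of_central hq hst (h.trans (h.mono hc) (h.symm hc')) hxy hx hgy
  · by_cases hex : ∃ x y, G.Adj x y ∧ BallEquiv G φ n x (s n) ∧ Generic (BallEquiv G φ) s u v n y
    · obtain ⟨x, y, hxy, hx, hgy⟩ := hex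
      refine ⟨L.A n, L.B n, ballClass G φ n y, ?_⟩
      rintro _ ⟨z, rfl⟩ hES hcan
      by_contra! hno
      obtain ⟨x', z', hxz, hx', hz⟩ := adj hcan
      have hgz := h.generic_congr hz (generic hno.1 hno.2.1 hES)
      exact hno.2.2 (ballClass_eq_iff.2
        (h.trans hz (h.generic_unique hq hst hxz hxy hx' hx hgz hgy)))
    · refine ⟨L.A n, L.B n, L.B n, ?_⟩
      rintro _ ⟨z, rfl⟩ hES hcan
      by_contra! hno
      obtain ⟨x', z', hxz, hx', hz⟩ := adj hcan
      exact hex ⟨x', z', hxz, hx', h.generic_congr hz (generic hno.1 hno.2.1 hES)⟩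

end Sturm
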